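/- Let B be a nondegenerate symmetric bilinear form on a finite-dimensional complex vector space V, let z_0, …, z_d be pairwise distinct complex numbers, and let v_0, …, v_d ∈ V be nonzero vectors with B(v_i, v_i) = 0 for all i. The assignment λ ↦ P_λ, where P_λ(z) = Σ_{i=0}^{d} λ_i L_i(z) v_i, is a bijection from the set {λ ∈ ℂ^{d+1} : λ_i ≠ 0 for all i, and (λ_0/ζ_0, …, λ_d/ζ_d) lies in the kernel of the rescaled skew-symmetric matrix A} onto the set of V-valued polynomials P of degree at most d such that B(P(z), P(z)) is identically zero and, for every i ∈ [0,d], P(z_i) is a nonzero scalar multiple of v_i. -/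

import Mathlib

/-- The `i`-th Lagrange basis polynomial for the nodes `z 0, …, z (N-1)`:
`L i (z) = ∏_{j ≠ i} (z - z j) / (z i - z j)`. -/
noncomputable def lagrangeBasis {N : ℕ} (z : Fin N → ℂ) (i : Fin N) : Polynomial ℂ :=
  ∏ j ∈ Finset.univ.erase i,
    Polynomial.C ((z i - z j)⁻¹) * (Polynomial.X - Polynomial.C (z j))

/-- `ζ i = ∏_{k ≠ i} (z i - z k)`. -/
noncomputable def nodeProd {N : ℕ} (z : Fin N → ℂ) (i : Fin N) : ℂ :=
  ∏ k ∈ Finset.univ.erase i, (z i - z k)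

/-- The rescaled skew-symmetric matrix `A` with `A i i = 0` and
`A i j = B (v i) (v j) / (z j - z i)` for `i ≠ j`. -/
noncomputable def rescaledMatrix {N : ℕ} {V : Type*} [AddCommGroup V] [Module ℂ V]
    (B : LinearMap.BilinForm ℂ V) (z : Fin N → ℂ) (v : Fin N → V) :
    Matrix (Fin N) (Fin N) ℂ :=
  Matrix.of fun i j => if i = j then 0 else B (v i) (v j) / (z j - z i)

theorem lagrangeBasis_eq_basis {N : ℕ} (z : Fin N → ℂ) (i : Fin N) :
    lagrangeBasis z i = Lagrange.basis Finset.univ z i := rfl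

theorem eval_lagrangeBasis_node {N : ℕ} {z : Fin N → ℂ} (hz : Function.Injective z)
    (i j : Fin N) : (lagrangeBasis z i).eval (z j) = if i = j then 1 else 0 := by
  rw [lagrangeBasis_eq_basis]
  split_ifs with h
  · subst h
    exact Lagrange.eval_basis_self hz.injOn (Finset.mem_univ _)
  · exact Lagrange.eval_basis_of_ne h (Finset.mem_univ _)

theorem natDegree_lagrangeBasis_lt {d : ℕ} {z : Fin (d + 1) → ℂ} (hz : Function.Injective z)
    (i : Fin (d + 1)) : (lagrangeBasis z i).natDegree < d + 1 := by
  have h := Lagrange.degree_basis (s := Finset.univ) hz.injOn (Finset.mem_univ i)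
  rw [lagrangeBasis_eq_basis, Polynomial.natDegree_eq_of_degree_eq_some h]
  simp

theorem nodeProd_ne_zero {N : ℕ} {z : Fin N → ℂ} (hz : Function.Injective z) (i : Fin N) :
    nodeProd z i ≠ 0 :=
  Finset.prod_ne_zero_iff.mpr fun _ hk =>
    sub_ne_zero.mpr fun h => Finset.ne_of_mem_erase hk (hz h).symm

/-- `(t - z i) ζ i L i (t)` is the nodal polynomial. -/
theorem sub_mul_nodeProd_mul_eval_lagrangeBasis {N : ℕ} {z : Fin N → ℂ}
    (hz : Function.Injective z) (i : Fin N) (t : ℂ) :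
    (t - z i) * (nodeProd z i * (lagrangeBasis z i).eval t) =
      (Lagrange.nodal Finset.univ z).eval t := by
  have h : nodeProd z i * (lagrangeBasis z i).eval t =
      ∏ k ∈ Finset.univ.erase i, (t - z k) := by
    rw [nodeProd, lagrangeBasis, Polynomial.eval_prod, ← Finset.prod_mul_distrib]
    refine Finset.prod_congr rfl fun k hk => ?_
    have : z i - z k ≠ 0 := sub_ne_zero.mpr fun h => Finset.ne_of_mem_erase hk (hz h).symm
    simp [this]
  rw [h, Lagrange.eval_nodal, Finset.mul_prod_erase _ (fun k => t - z k) (Finset.mem_univ i)]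

/-- The value of the quadratic form along `∑ i, λ i L i (t) • v i` in terms of the rescaled
matrix: it equals `-2 N(t) ∑ i, λ i (A μ) i L i (t)` with `N` the nodal polynomial and
`μ i = λ i / ζ i`. -/
theorem bilin_lagrange_sum_self {N : ℕ} {V : Type*} [AddCommGroup V] [Module ℂ V]
    (B : LinearMap.BilinForm ℂ V) (hB : ∀ x y, B x y = B y x)
    {z : Fin N → ℂ} (hz : Function.Injective z) {v : Fin N → V}
    (hiso : ∀ i, B (v i) (v i) = 0) (lam : Fin N → ℂ) (t : ℂ) :
    B (∑ i, (lam i * (lagrangeBasis z i).eval t) • v i)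
        (∑ i, (lam i * (lagrangeBasis z i).eval t) • v i) =
      -2 * (Lagrange.nodal Finset.univ z).eval t *
        ∑ i, lam i * (rescaledMatrix B z v).mulVec (fun j => lam j / nodeProd z j) i *
          (lagrangeBasis z i).eval t := by
  set n := (Lagrange.nodal Finset.univ z).eval t
  set L := fun i => (lagrangeBasis z i).eval t with hL
  set g : Fin N → Fin N → ℂ := fun i j =>
    lam i * (rescaledMatrix B z v i j * (lam j / nodeProd z j)) * L i with hg
  have hterm : ∀ i j, lam i * L i * (lam j * L j * B (v i) (v j)) = -n * (g i j + g j i) := by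
    intro i j
    by_cases hij : i = j
    · subst hij
      simp [hg, rescaledMatrix, hiso]
    · have hi := nodeProd_ne_zero hz i
      have hj := nodeProd_ne_zero hz j
      have h1 : z j - z i ≠ 0 := sub_ne_zero.mpr fun h => hij (hz h).symm
      have h2 : z i - z j ≠ 0 := sub_ne_zero.mpr fun h => hij (hz h)
      have ei : (t - z i) * (nodeProd z i * L i) = n :=
        sub_mul_nodeProd_mul_eval_lagrangeBasis hz i t
      have ej : (t - z j) * (nodeProd z j * L j) = n :=
        sub_mul_nodeProd_mul_eval_lagrangeBasis hz j t
      have key : nodeProd z i * nodeProd z j * (z j - z i) * (L i * L j) =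
          -n * (nodeProd z i * L i - nodeProd z j * L j) := by
        linear_combination nodeProd z j * L j * ei - nodeProd z i * L i * ej
      have hne : nodeProd z i * nodeProd z j * (z j - z i) ≠ 0 :=
        mul_ne_zero (mul_ne_zero hi hj) h1
      have hsum : g i j + g j i = lam i * lam j * B (v i) (v j) *
          (nodeProd z i * L i - nodeProd z j * L j) /
            (nodeProd z i * nodeProd z j * (z j - z i)) := by
        simp only [hg, rescaledMatrix, Matrix.of_apply, if_neg hij, if_neg (Ne.symm hij),
          hB (v j) (v i)]
        rw [← neg_sub (z j) (z i)]
        field_simp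
        ring
      rw [hsum, mul_div_assoc', eq_div_iff hne]
      linear_combination lam i * lam j * B (v i) (v j) * key
  have hR : ∑ i, lam i * (rescaledMatrix B z v).mulVec (fun j => lam j / nodeProd z j) i * L i =
      ∑ i, ∑ j, g i j := by
    simp only [hg, Matrix.mulVec, dotProduct, Finset.mul_sum, Finset.sum_mul]
  calc _ = ∑ i, ∑ j, lam i * L i * (lam j * L j * B (v i) (v j)) := by
        simp only [map_sum, map_smul, LinearMap.sum_apply, LinearMap.smul_apply, smul_eq_mul,
          Finset.mul_sum, hL]
        rw [Finset.sum_comm]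
        refine Finset.sum_congr rfl fun i _ => Finset.sum_congr rfl fun j _ => ?_
        ring
    _ = -n * (∑ i, ∑ j, g i j + ∑ i, ∑ j, g j i) := by
        simp only [hterm, ← Finset.mul_sum, Finset.sum_add_distrib]
    _ = _ := by
        rw [hR, Finset.sum_comm (f := fun i j => g j i)]
        ring

theorem lagrange_sum_node {N : ℕ} {V : Type*} [AddCommGroup V] [Module ℂ V]
    {z : Fin N → ℂ} (hz : Function.Injective z) (v : Fin N → V) (lam : Fin N → ℂ)
    (j : Fin N) : ∑ i, (lam i * (lagrangeBasis z i).eval (z j)) • v i = lam j • v j := by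
  simp [eval_lagrangeBasis_node hz]

/-- The quadratic form vanishes identically along `∑ i, λ i L i (t) • v i` if and only if
`λ i (A μ) i = 0` for all `i`, where `μ i = λ i / ζ i`. -/
theorem bilin_lagrange_sum_self_eq_zero_iff {N : ℕ} {V : Type*} [AddCommGroup V] [Module ℂ V]
    (B : LinearMap.BilinForm ℂ V) (hB : ∀ x y, B x y = B y x)
    {z : Fin N → ℂ} (hz : Function.Injective z) {v : Fin N → V}
    (hiso : ∀ i, B (v i) (v i) = 0) (lam : Fin N → ℂ) :
    (∀ t : ℂ, B (∑ i, (lam i * (lagrangeBasis z i).eval t) • v i)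
        (∑ i, (lam i * (lagrangeBasis z i).eval t) • v i) = 0) ↔
      ∀ i, lam i * (rescaledMatrix B z v).mulVec (fun j => lam j / nodeProd z j) i = 0 := by
  simp only [bilin_lagrange_sum_self B hB hz hiso]
  set w := (rescaledMatrix B z v).mulVec (fun j => lam j / nodeProd z j)
  refine ⟨fun h i => ?_, fun h t => by simp [h]⟩
  have hp : Lagrange.nodal Finset.univ z *
      ∑ i, Polynomial.C (lam i * w i) * lagrangeBasis z i = 0 := by
    refine Polynomial.funext fun t => ?_
    have ht := h t
    rw [mul_assoc] at ht
    simpa [Polynomial.eval_finsetSum] using ht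
  have hq := (mul_eq_zero.mp hp).resolve_left (Lagrange.nodal_ne_zero)
  have he := congrArg (Polynomial.eval (z i)) hq
  simpa [Polynomial.eval_finsetSum, eval_lagrangeBasis_node hz] using he

/-- Lagrange interpolation for vector-valued polynomial functions. -/
theorem sum_pow_smul_eq_lagrange_sum {d : ℕ} {V : Type*} [AddCommGroup V] [Module ℂ V]
    {z : Fin (d + 1) → ℂ} (hz : Function.Injective z) (c : Fin (d + 1) → V) (t : ℂ) :
    ∑ k : Fin (d + 1), (t ^ (k : ℕ)) • c k =
      ∑ i, (lagrangeBasis z i).eval t • ∑ k : Fin (d + 1), (z i ^ (k : ℕ)) • c k := by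
  have hpow : ∀ k : Fin (d + 1), t ^ (k : ℕ) = ∑ i, (lagrangeBasis z i).eval t * z i ^ (k : ℕ) := by
    intro k
    have h := Lagrange.eq_interpolate (s := Finset.univ) (v := z)
      (f := (Polynomial.X : Polynomial ℂ) ^ (k : ℕ)) hz.injOn (by
        rw [Polynomial.degree_X_pow]
        simpa only [Finset.card_univ, Fintype.card_fin] using Nat.cast_lt.mpr k.2)
    have he := congrArg (Polynomial.eval t) h
    simpa [Lagrange.interpolate_apply, Polynomial.eval_finsetSum, lagrangeBasis_eq_basis,
      mul_comm] using he
  simp only [Finset.smul_sum, smul_smul]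
  rw [Finset.sum_comm]
  exact Finset.sum_congr rfl fun k _ => by rw [hpow k, Finset.sum_smul]

/-- `∑ i, λ i L i (t) • v i` is a polynomial function of degree at most `d`. -/
theorem exists_lagrange_sum_eq_sum_pow_smul {d : ℕ} {V : Type*} [AddCommGroup V] [Module ℂ V]
    {z : Fin (d + 1) → ℂ} (hz : Function.Injective z) (v : Fin (d + 1) → V)
    (lam : Fin (d + 1) → ℂ) :
    ∃ c : Fin (d + 1) → V, ∀ t : ℂ, ∑ i, (lam i * (lagrangeBasis z i).eval t) • v i =
      ∑ k : Fin (d + 1), (t ^ (k : ℕ)) • c k := by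
  refine ⟨fun k => ∑ i, (lam i * (lagrangeBasis z i).coeff k) • v i, fun t => ?_⟩
  simp only [Finset.smul_sum, smul_smul]
  rw [Finset.sum_comm]
  refine Finset.sum_congr rfl fun i _ => ?_
  rw [Polynomial.eval_eq_sum_range' (natDegree_lagrangeBasis_lt hz i),
    ← Fin.sum_univ_eq_sum_range (fun k => (lagrangeBasis z i).coeff k * t ^ k),
    Finset.mul_sum, Finset.sum_smul]
  refine Finset.sum_congr rfl fun k _ => ?_
  congr 1
  ring

/-- For a nondegenerate symmetric bilinear form `B` on a finite-dimensional complex vector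
space `V`, pairwise distinct nodes `z 0, …, z d` and nonzero isotropic vectors
`v 0, …, v d`, the map `λ ↦ P_λ`, with `P_λ (t) = ∑ i, λ i * L i (t) • v i`, is a bijection
from the set of `λ` with all entries nonzero such that `(λ_i/ζ_i)_i ∈ Ker A`, onto the set
of `V`-valued polynomial functions of degree at most `d` taking values in the quadric
`{B(x,x) = 0}` and whose value at each `z i` is a nonzero scalar multiple of `v i`. -/
theorem lagrange_parametrization_of_morphisms_to_quadric
    (d : ℕ) {V : Type*} [AddCommGroup V] [Module ℂ V] [FiniteDimensional ℂ V]
    (B : LinearMap.BilinForm ℂ V) (hB : ∀ x y, B x y = B y x)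
    (hnondeg : ∀ x : V, (∀ y : V, B x y = 0) → x = 0)
    (z : Fin (d + 1) → ℂ) (hz : Function.Injective z)
    (v : Fin (d + 1) → V) (hv : ∀ i, v i ≠ 0) (hiso : ∀ i, B (v i) (v i) = 0) :
    Set.BijOn
      (fun lam : Fin (d + 1) → ℂ => fun t : ℂ =>
        ∑ i : Fin (d + 1), (lam i * (lagrangeBasis z i).eval t) • v i)
      {lam : Fin (d + 1) → ℂ | (∀ i, lam i ≠ 0) ∧
        (rescaledMatrix B z v).mulVec (fun i => lam i / nodeProd z i) = 0}
      {P : ℂ → V |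
        (∃ c : Fin (d + 1) → V, ∀ t : ℂ, P t = ∑ k : Fin (d + 1), (t ^ (k : ℕ)) • c k) ∧
        (∀ t : ℂ, B (P t) (P t) = 0) ∧
        ∀ i, ∃ a : ℂ, a ≠ 0 ∧ P (z i) = a • v i} := by
  refine ⟨?_, ?_, ?_⟩
  · rintro lam ⟨hlam, hker⟩
    refine ⟨exists_lagrange_sum_eq_sum_pow_smul hz v lam, ?_,
      fun i => ⟨lam i, hlam i, lagrange_sum_node hz v lam i⟩⟩
    exact (bilin_lagrange_sum_self_eq_zero_iff B hB hz hiso lam).mpr fun i => by simp [hker]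
  · intro lam _ lam' _ h
    ext i
    have hi := congrFun h (z i)
    simp only [lagrange_sum_node hz] at hi
    exact smul_left_injective ℂ (hv i) hi
  · rintro P ⟨⟨c, hc⟩, hq, hnode⟩
    choose a ha hPa using hnode
    have hP : (fun t : ℂ => ∑ i, (a i * (lagrangeBasis z i).eval t) • v i) = P := by
      funext t
      rw [hc t, sum_pow_smul_eq_lagrange_sum hz]
      refine Finset.sum_congr rfl fun i _ => ?_
      rw [← hc, hPa, smul_smul, mul_comm]
    refine ⟨a, ⟨ha, ?_⟩, hP⟩
    subst hP
    funext i
    exact (mul_eq_zero.mp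
      ((bilin_lagrange_sum_self_eq_zero_iff B hB hz hiso a).mp hq i)).resolve_left (ha i)
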